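/- arXiv:2602.17920 — 2 statements merged into one kernel-verified Lean document; each statement's English description precedes it below -/
import Mathlib

section
/- Let P be a ν-partition of G whose boundary satisfies |∂P| = ν − 1 (equivalently, the first Betti number η = |∂P| − (ν−1) of the partition multigraph is zero, i.e. P is a tree partition). Suppose (P, α̃) is an equipartition for some α̃ ∈ ℝ^{∂P} with all entries positive. Then: (1) α̃ is the unique such parameter vector, i.e. if (P, α′) is also an equipartition with all entries of α′ positive then α′ = α̃; and (2) there is an eigenvector ψ of L^{∂P} with strictly positive entries whose eigenvalue is Λ(P, α̃), and Λ(P, α̃) is the ν-th smallest eigenvalue of L^{∂P} (so ψ is Courant-sharp, having exactly ν nodal domains with respect to σ^{∂P}, namely the parts of P). -/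
open Matrix Finset

noncomputable section

variable {V : Type*}

/-- The signed Laplacian of the weighted graph `(G,w)` with signature `σ`. -/
def signedLaplacian [Fintype V] [DecidableEq V] (G : SimpleGraph V) [DecidableRel G.Adj]
    (w σ : V → V → ℝ) : Matrix V V ℝ :=
  Matrix.of fun i j =>
    if i = j then ∑ k, if G.Adj i k then w i k else 0
    else if G.Adj i j then -(σ i j * w i j) else 0

/-- The `n`-th smallest eigenvalue (1-based, counted with multiplicity) of a real
symmetric matrix; junk value `0` if the matrix is not Hermitian or `n` is out of range. -/
def nthEigenvalue [Fintype V] [DecidableEq V] (A : Matrix V V ℝ) (n : ℕ) : ℝ :=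
  if h : A.IsHermitian ∧ n - 1 < Fintype.card V then
    let f : Fin (Fintype.card V) → ℝ := fun i => h.1.eigenvalues ((Fintype.equivFin V).symm i)
    f (Tuple.sort f ⟨n - 1, h.2⟩)
  else 0

/-- `μ` is a simple eigenvalue of `A`: its eigenspace is one-dimensional. -/
def IsSimpleEigenvalue [Fintype V] [DecidableEq V] (A : Matrix V V ℝ) (μ : ℝ) : Prop :=
  Module.finrank ℝ (Module.End.eigenspace (Matrix.toLin' A) μ) = 1

/-- The nodal set of `u` with respect to the signature `σ`, as a set of (unordered) edges. -/
def nodalEdges (G : SimpleGraph V) (σ : V → V → ℝ) (u : V → ℝ) : Set (Sym2 V) :=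
  {e | ∃ i j, e = s(i, j) ∧ G.Adj i j ∧ u i * σ i j * u j < 0}

/-- The number of nodal domains of `u` on `(G,σ)`: the number of connected components
of the spanning subgraph obtained by deleting the nodal set. -/
def nodalCount (G : SimpleGraph V) (σ : V → V → ℝ) (u : V → ℝ) : ℕ :=
  Nat.card (G.deleteEdges (nodalEdges G σ u)).ConnectedComponent

/-- `(G,σ)` is balanced: every cycle has positive sign. -/
def IsBalanced (G : SimpleGraph V) (σ : V → V → ℝ) : Prop :=
  ∀ ⦃v : V⦄ (p : G.Walk v v), p.IsCycle →
    0 < (p.darts.map fun d => σ d.toProd.1 d.toProd.2).prod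

/-- The matrix `B_{ij}(a)`. -/
def Bmat [DecidableEq V] (i j : V) (a : ℝ) : Matrix V V ℝ :=
  Matrix.of fun x y =>
    if x = i ∧ y = i then a
    else if x = j ∧ y = j then a⁻¹
    else if (x = i ∧ y = j) ∨ (x = j ∧ y = i) then -1
    else 0

/-- The signature `σ^{∂P}` determined by the partition `P`. -/
def partSgn {ν : ℕ} (P : V → Fin ν) (i j : V) : ℝ :=
  if P i = P j then 1 else -1

/-- `L^{∂P}(P,α)`: the partition Laplacian perturbed by the rank-one parameter matrices
on the oriented boundary edges `O`. -/
def paramMatrix [Fintype V] [DecidableEq V] (G : SimpleGraph V) [DecidableRel G.Adj]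
    (w : V → V → ℝ) {ν : ℕ} (P : V → Fin ν) (O : Finset (V × V)) (α : V × V → ℝ) :
    Matrix V V ℝ :=
  signedLaplacian G w (partSgn P) + ∑ p ∈ O, w p.1 p.2 • Bmat p.1 p.2 (α p)

/-- The principal submatrix of `M` on the `k`-th part of the partition `P`. -/
def blockMatrix {ν : ℕ} (M : Matrix V V ℝ) (P : V → Fin ν) (k : Fin ν) :
    Matrix {v : V // P v = k} {v : V // P v = k} ℝ :=
  M.submatrix Subtype.val Subtype.val

/-- `λ₁(G_k, α)`: the smallest eigenvalue of the block of `L^{∂P}(P,α)` on part `k`. -/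
def lam1Block [Fintype V] [DecidableEq V] {ν : ℕ} (M : Matrix V V ℝ) (P : V → Fin ν)
    (k : Fin ν) : ℝ :=
  nthEigenvalue (blockMatrix M P k) 1

/-- The partition energy `Λ(P, α) = max_k λ₁(G_k, α)`. -/
def PartitionEnergy [Fintype V] [DecidableEq V] (G : SimpleGraph V) [DecidableRel G.Adj]
    (w : V → V → ℝ) {ν : ℕ} (P : V → Fin ν) (O : Finset (V × V)) (α : V × V → ℝ) : ℝ :=
  ⨆ k : Fin ν, lam1Block (paramMatrix G w P O α) P k

/-- `(P, α)` is an equipartition: all the first block eigenvalues agree. -/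
def IsEquipartition [Fintype V] [DecidableEq V] (G : SimpleGraph V) [DecidableRel G.Adj]
    (w : V → V → ℝ) {ν : ℕ} (P : V → Fin ν) (O : Finset (V × V)) (α : V × V → ℝ) : Prop :=
  ∀ k l : Fin ν, lam1Block (paramMatrix G w P O α) P k = lam1Block (paramMatrix G w P O α) P l



/-! ### Spectral lemmas -/

lemma nth_spec [Fintype V] [DecidableEq V] {A : Matrix V V ℝ} (hA : A.IsHermitian) :
    ∃ (μ : Fin (Fintype.card V) → ℝ) (T : (V → ℝ) →ₗ[ℝ] (Fin (Fintype.card V) → ℝ)),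
      Monotone μ ∧ (∀ x, x ⬝ᵥ (A *ᵥ x) = ∑ i, μ i * (T x i) ^ 2) ∧
      (∀ x, x ⬝ᵥ x = ∑ i, (T x i) ^ 2) ∧
      ∀ n (h : n - 1 < Fintype.card V), nthEigenvalue A n = μ ⟨n - 1, h⟩ := by
  classical
  set f : Fin (Fintype.card V) → ℝ := fun i => hA.eigenvalues ((Fintype.equivFin V).symm i) with hf
  set e : Fin (Fintype.card V) ≃ V := (Tuple.sort f).trans (Fintype.equivFin V).symm with he
  set U : Matrix V V ℝ := (hA.eigenvectorUnitary : Matrix V V ℝ) with hU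
  have hUU : U * star U = 1 := Unitary.coe_mul_star_self hA.eigenvectorUnitary
  have hspec : A = U * diagonal hA.eigenvalues * star U := by
    have := hA.spectral_theorem
    simpa [Unitary.conjStarAlgAut_apply, Function.comp_def] using this
  have hstar : star U = Uᵀ := by
    rw [star_eq_conjTranspose]; ext i j; simp
  refine ⟨f ∘ Tuple.sort f, (LinearMap.funLeft ℝ ℝ e) ∘ₗ Matrix.toLin' (star U),
    Tuple.monotone_sort f, ?_, ?_, ?_⟩
  · intro x
    have h1 : x ⬝ᵥ (A *ᵥ x) = (star U *ᵥ x) ⬝ᵥ (diagonal hA.eigenvalues *ᵥ (star U *ᵥ x)) := by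
      conv_lhs => rw [hspec]
      rw [← mulVec_mulVec, ← mulVec_mulVec, dotProduct_mulVec, hstar, mulVec_transpose]
    rw [h1, dotProduct, ← e.sum_comp]
    refine Finset.sum_congr rfl fun i _ => ?_
    simp [mulVec_diagonal, LinearMap.funLeft_apply, hf, he]
    ring
  · intro x
    have h1 : x ⬝ᵥ x = (star U *ᵥ x) ⬝ᵥ (star U *ᵥ x) := by
      rw [dotProduct_mulVec, hstar, ← mulVec_transpose, transpose_transpose, mulVec_mulVec,
        ← hstar, hUU, one_mulVec]
    rw [h1, dotProduct, ← e.sum_comp]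
    refine Finset.sum_congr rfl fun i _ => ?_
    simp [LinearMap.funLeft_apply]
    ring
  · intro n h
    rw [nthEigenvalue, dif_pos ⟨hA, h⟩]
    rfl

lemma dot_pos [Fintype V] {x : V → ℝ} (hx : x ≠ 0) : 0 < x ⬝ᵥ x := by
  have h0 : 0 ≤ x ⬝ᵥ x := Finset.sum_nonneg fun i _ => mul_self_nonneg _
  exact lt_of_le_of_ne h0 fun h => hx (dotProduct_self_eq_zero.1 h.symm)

lemma nth_le [Fintype V] [DecidableEq V] {A : Matrix V V ℝ} (hA : A.IsHermitian) {n : ℕ}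
    (hn : 1 ≤ n) (hnV : n ≤ Fintype.card V) (J : (Fin n → ℝ) →ₗ[ℝ] (V → ℝ))
    (hJ : Function.Injective J) {c : ℝ} (h : ∀ y, J y ⬝ᵥ (A *ᵥ J y) ≤ c * (J y ⬝ᵥ J y)) :
    nthEigenvalue A n ≤ c := by
  obtain ⟨μ, T, hmono, hq, hn2, hnth⟩ := nth_spec hA
  have hlt : n - 1 < Fintype.card V := by omega
  rw [hnth n hlt]
  let R : (Fin n → ℝ) →ₗ[ℝ] (Fin (n - 1) → ℝ) :=
    (LinearMap.funLeft ℝ ℝ (fun m : Fin (n - 1) => (⟨m, by omega⟩ : Fin (Fintype.card V)))) ∘ₗ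
      T ∘ₗ J
  have hR : LinearMap.ker R ≠ ⊥ := LinearMap.ker_ne_bot_of_finrank_lt (by simp; omega)
  obtain ⟨y, hy, hy0⟩ := (Submodule.ne_bot_iff _).1 hR
  have hx0 : J y ≠ 0 := fun h0 => hy0 (hJ (by rw [h0, map_zero]))
  have hz : ∀ i : Fin (Fintype.card V), (i : ℕ) < n - 1 → T (J y) i = 0 := fun i hi =>
    congrFun (LinearMap.mem_ker.1 hy) ⟨i, hi⟩
  have h2 : μ ⟨n - 1, hlt⟩ * (J y ⬝ᵥ J y) ≤ J y ⬝ᵥ (A *ᵥ J y) := by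
    rw [hq, hn2, Finset.mul_sum]
    refine Finset.sum_le_sum fun i _ => ?_
    by_cases hi : (i : ℕ) < n - 1
    · simp [hz i hi]
    · exact mul_le_mul_of_nonneg_right (hmono (Fin.le_def.2 (by simpa using hi))) (sq_nonneg _)
  exact le_of_mul_le_mul_right (h2.trans (h y)) (dot_pos hx0)

lemma exists_low [Fintype V] [DecidableEq V] {A : Matrix V V ℝ} (hA : A.IsHermitian) {n : ℕ}
    (hn : 1 ≤ n) (hnV : n ≤ Fintype.card V) {ι : Type*} [Fintype ι] (D : (V → ℝ) →ₗ[ℝ] (ι → ℝ))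
    (hι : Fintype.card ι ≤ n - 1) :
    ∃ x, x ≠ 0 ∧ D x = 0 ∧ x ⬝ᵥ (A *ᵥ x) ≤ nthEigenvalue A n * (x ⬝ᵥ x) := by
  obtain ⟨μ, T, hmono, hq, hn2, hnth⟩ := nth_spec hA
  have hlt : n - 1 < Fintype.card V := by omega
  rw [hnth n hlt]
  let R : (V → ℝ) →ₗ[ℝ] (ι → ℝ) × (Fin (Fintype.card V - n) → ℝ) :=
    D.prod ((LinearMap.funLeft ℝ ℝ (fun m : Fin (Fintype.card V - n) =>
      (⟨n + m, by omega⟩ : Fin (Fintype.card V)))) ∘ₗ T)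
  have hR : LinearMap.ker R ≠ ⊥ := LinearMap.ker_ne_bot_of_finrank_lt (by simp; omega)
  obtain ⟨x, hx, hx0⟩ := (Submodule.ne_bot_iff _).1 hR
  have hx' := Prod.ext_iff.1 (LinearMap.mem_ker.1 hx)
  have hz : ∀ i : Fin (Fintype.card V), n ≤ (i : ℕ) → T x i = 0 := fun i hi => by
    have := congrFun hx'.2 ⟨i - n, by omega⟩
    have h3 : (⟨n + (i - n), by omega⟩ : Fin (Fintype.card V)) = i := Fin.ext (by simp; omega)
    simpa [R, LinearMap.funLeft_apply, h3] using this
  refine ⟨x, hx0, hx'.1, ?_⟩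
  rw [hq, hn2, Finset.mul_sum]
  refine Finset.sum_le_sum fun i _ => ?_
  by_cases hi : n ≤ (i : ℕ)
  · simp [hz i hi]
  · exact mul_le_mul_of_nonneg_right (hmono (Fin.le_def.2 (by simp; omega))) (sq_nonneg _)

lemma first_le [Fintype V] [DecidableEq V] [Nonempty V] {A : Matrix V V ℝ}
    (hA : A.IsHermitian) (x : V → ℝ) : nthEigenvalue A 1 * (x ⬝ᵥ x) ≤ x ⬝ᵥ (A *ᵥ x) := by
  obtain ⟨μ, T, hmono, hq, hn2, hnth⟩ := nth_spec hA
  have hlt : 1 - 1 < Fintype.card V := Fintype.card_pos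
  rw [hnth 1 hlt, hq, hn2, Finset.mul_sum]
  refine Finset.sum_le_sum fun i _ => ?_
  exact mul_le_mul_of_nonneg_right (hmono (Fin.le_def.2 (by simp))) (sq_nonneg _)

lemma perron [Fintype V] [DecidableEq V] {A : Matrix V V ℝ} (hA : A.IsHermitian)
    (H : SimpleGraph V) (hH : H.Connected) (hoff : ∀ i j, i ≠ j → A i j ≤ 0)
    (hadj : ∀ i j, H.Adj i j → A i j < 0) :
    ∃ φ : V → ℝ, (∀ v, 0 < φ v) ∧ A *ᵥ φ = nthEigenvalue A 1 • φ := by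
  have := hH.nonempty
  obtain ⟨x, hx0, -, hx⟩ := exists_low hA le_rfl Fintype.card_pos
    (0 : (V → ℝ) →ₗ[ℝ] (Fin 0 → ℝ)) (by simp)
  set lam := nthEigenvalue A 1 with hlam
  set φ : V → ℝ := fun v => |x v| with hφ
  have hnorm : φ ⬝ᵥ φ = x ⬝ᵥ x := by simp [dotProduct, hφ]
  have hquad : φ ⬝ᵥ (A *ᵥ φ) ≤ x ⬝ᵥ (A *ᵥ x) := by
    simp only [dotProduct, mulVec, Finset.mul_sum]
    refine Finset.sum_le_sum fun i _ => Finset.sum_le_sum fun j _ => ?_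
    by_cases hij : i = j
    · subst hij
      have : φ i * (A i i * φ i) = x i * (A i i * x i) := by
        have := abs_mul_abs_self (x i)
        simp only [hφ]; linear_combination A i i * this
      exact this.le
    · have h1 := hoff i j hij
      have h2 : x i * x j ≤ φ i * φ j := by
        simp only [hφ]; rw [← abs_mul]; exact le_abs_self _
      nlinarith
  have hpsd : (A - lam • (1 : Matrix V V ℝ)).PosSemidef := by
    refine Matrix.PosSemidef.of_dotProduct_mulVec_nonneg ?_ ?_
    · exact hA.sub (by simp [Matrix.IsHermitian])
    · intro y
      have := first_le hA y
      simp [sub_mulVec, smul_mulVec, dotProduct_sub]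
      linarith
  have hev : A *ᵥ φ = lam • φ := by
    have h0 : star φ ⬝ᵥ ((A - lam • (1 : Matrix V V ℝ)) *ᵥ φ) = 0 := by
      have := first_le hA φ
      simp [sub_mulVec, smul_mulVec, dotProduct_sub]
      have h4 : φ ⬝ᵥ (A *ᵥ φ) ≤ lam * (φ ⬝ᵥ φ) := by rw [hnorm]; exact hquad.trans hx
      linarith
    have := (hpsd.dotProduct_mulVec_zero_iff φ).1 h0
    simpa [sub_mulVec, smul_mulVec, sub_eq_zero] using this
  have hstep : ∀ i j, H.Adj i j → φ i = 0 → φ j = 0 := by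
    intro i j hij hi
    have h1 : ∑ k, A i k * φ k = 0 := by
      have := congrFun hev i
      simpa [mulVec, dotProduct, hi] using this
    have h2 : ∀ k ∈ Finset.univ, A i k * φ k ≤ 0 := by
      intro k _
      by_cases hik : i = k
      · subst hik; simp [hi]
      · exact mul_nonpos_of_nonpos_of_nonneg (hoff i k hik) (abs_nonneg _)
    have h3 := (Finset.sum_eq_zero_iff_of_nonpos h2).1 h1 j (Finset.mem_univ _)
    rcases mul_eq_zero.1 h3 with h | h
    · exact absurd h (hadj i j hij).ne
    · exact h
  refine ⟨φ, fun v => ?_, hev⟩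
  refine lt_of_le_of_ne (abs_nonneg _) fun hv => hx0 ?_
  have hall : ∀ u, φ u = 0 := by
    intro u
    obtain ⟨p⟩ := hH.preconnected v u
    have hv' : φ v = 0 := hv.symm
    clear hv
    induction p with
    | nil => exact hv'
    | cons hadj' _ ih => exact ih (hstep _ _ hadj' hv')
  funext u
  exact abs_eq_zero.1 (hall u)

/-- Picone-type inequality. -/
lemma picone [Fintype V] {A : Matrix V V ℝ} (hA : ∀ i j, A i j = A j i)
    (hoff : ∀ i j, i ≠ j → A i j ≤ 0) {ψ : V → ℝ} (hψ : ∀ v, 0 < ψ v) {c : ℝ}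
    (hev : A *ᵥ ψ = c • ψ) (x : V → ℝ) : c * (x ⬝ᵥ x) ≤ x ⬝ᵥ (A *ᵥ x) := by
  set y : V → ℝ := fun v => x v / ψ v with hy
  have hx : ∀ v, x v = ψ v * y v := fun v => by
    simp only [hy]; field_simp [(hψ v).ne']
  have h1 : ∑ i, ∑ j, A i j * (ψ i * ψ j * (y i) ^ 2) = c * (x ⬝ᵥ x) := by
    rw [dotProduct, Finset.mul_sum]
    refine Finset.sum_congr rfl fun i _ => ?_
    have := congrFun hev i
    simp only [mulVec, dotProduct, Pi.smul_apply, smul_eq_mul] at this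
    have h : ∑ j, A i j * (ψ i * ψ j * (y i) ^ 2) = (ψ i * (y i) ^ 2) * ∑ j, A i j * ψ j := by
      rw [Finset.mul_sum]; exact Finset.sum_congr rfl fun j _ => by ring
    rw [h, this, hx]; ring
  have h2 : ∑ i, ∑ j, A i j * (ψ i * ψ j * (y j) ^ 2) = c * (x ⬝ᵥ x) := by
    rw [← h1, Finset.sum_comm]
    refine Finset.sum_congr rfl fun i _ => Finset.sum_congr rfl fun j _ => ?_
    rw [hA j i]; ring
  have h3 : x ⬝ᵥ (A *ᵥ x) = ∑ i, ∑ j, A i j * (ψ i * ψ j * (y i * y j)) := by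
    simp only [dotProduct, mulVec, Finset.mul_sum]
    refine Finset.sum_congr rfl fun i _ => Finset.sum_congr rfl fun j _ => ?_
    rw [hx i, hx j]; ring
  have h4 : ∑ i, ∑ j, A i j * (ψ i * ψ j * (y i - y j) ^ 2) ≤ 0 := by
    refine Finset.sum_nonpos fun i _ => Finset.sum_nonpos fun j _ => ?_
    by_cases hij : i = j
    · subst hij; simp
    · exact mul_nonpos_of_nonpos_of_nonneg (hoff i j hij)
        (mul_nonneg (mul_pos (hψ i) (hψ j)).le (sq_nonneg _))
  have h5 : ∑ i, ∑ j, A i j * (ψ i * ψ j * (y i - y j) ^ 2) =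
      c * (x ⬝ᵥ x) + c * (x ⬝ᵥ x) - 2 * (x ⬝ᵥ (A *ᵥ x)) := by
    rw [h3, ← h2]
    nth_rw 2 [h2]
    rw [← h1]
    simp only [Finset.mul_sum, ← Finset.sum_add_distrib, ← Finset.sum_sub_distrib]
    refine Finset.sum_congr rfl fun i _ => Finset.sum_congr rfl fun j _ => ?_
    ring
  linarith

/-! ### The parameter matrices -/

lemma Bmat_mulVec [Fintype V] [DecidableEq V] {i j : V} (hij : i ≠ j) (a : ℝ) (x : V → ℝ) :
    Bmat i j a *ᵥ x = Pi.single i (a * x i - x j) + Pi.single j (a⁻¹ * x j - x i) := by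
  have h : Bmat i j a = Matrix.single i i a + Matrix.single j j a⁻¹
      - Matrix.single i j 1 - Matrix.single j i 1 := by
    ext u v
    simp only [Bmat, Matrix.of_apply, Matrix.add_apply, Matrix.sub_apply, Matrix.single_apply]
    by_cases h1 : u = i <;> by_cases h2 : v = i <;> by_cases h3 : u = j <;> by_cases h4 : v = j <;>
      simp_all [eq_comm]
  rw [h]
  simp only [sub_mulVec, add_mulVec]
  ext u
  simp only [Matrix.single_mulVec, Pi.add_apply, Pi.sub_apply, Function.update_apply,
    Pi.single_apply, Pi.zero_apply]
  split_ifs <;> ring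

lemma dot_Bmat [Fintype V] [DecidableEq V] {i j : V} (hij : i ≠ j) (a : ℝ) (x y : V → ℝ) :
    y ⬝ᵥ (Bmat i j a *ᵥ x) = y i * (a * x i - x j) + y j * (a⁻¹ * x j - x i) := by
  rw [Bmat_mulVec hij, dotProduct_add, dotProduct_single, dotProduct_single]

lemma Bmat_symm [DecidableEq V] (i j : V) (a : ℝ) (u v : V) :
    Bmat i j a u v = Bmat i j a v u := by
  simp only [Bmat, Matrix.of_apply]
  by_cases h1 : u = i <;> by_cases h2 : v = i <;> by_cases h3 : u = j <;> by_cases h4 : v = j <;>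
    simp_all

lemma sl_symm [Fintype V] [DecidableEq V] (G : SimpleGraph V) [DecidableRel G.Adj]
    (w : V → V → ℝ) (hw : ∀ i j, w i j = w j i) {ν : ℕ} (P : V → Fin ν) (i j : V) :
    signedLaplacian G w (partSgn P) i j = signedLaplacian G w (partSgn P) j i := by
  by_cases h : i = j
  · rw [h]
  · simp only [signedLaplacian, Matrix.of_apply, if_neg h, if_neg (Ne.symm h), G.adj_comm j i,
      hw j i, partSgn, eq_comm (a := P j)]

lemma pm_symm [Fintype V] [DecidableEq V] (G : SimpleGraph V) [DecidableRel G.Adj]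
    (w : V → V → ℝ) (hw : ∀ i j, w i j = w j i) {ν : ℕ} (P : V → Fin ν)
    (O : Finset (V × V)) (α : V × V → ℝ) (i j : V) :
    paramMatrix G w P O α i j = paramMatrix G w P O α j i := by
  simp only [paramMatrix, Matrix.add_apply, Matrix.sum_apply, Matrix.smul_apply]
  rw [sl_symm G w hw P i j]
  congr 1
  exact Finset.sum_congr rfl fun p _ => by rw [Bmat_symm]

lemma pm_off [Fintype V] [DecidableEq V] (G : SimpleGraph V) [DecidableRel G.Adj]
    (w : V → V → ℝ) (hwsymm : ∀ i j, w i j = w j i)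
    (hw0 : ∀ i j, ¬ G.Adj i j → w i j = 0) {ν : ℕ} (P : V → Fin ν)
    (O : Finset (V × V))
    (hO : ∀ p ∈ O, G.Adj p.1 p.2 ∧ P p.1 ≠ P p.2)
    (hOorient : ∀ i j, G.Adj i j → P i ≠ P j → ((i, j) ∈ O ↔ (j, i) ∉ O))
    (α : V × V → ℝ) {i j : V} (hij : i ≠ j) :
    paramMatrix G w P O α i j = if P i = P j then - w i j else 0 := by
  have hsum : ∑ p ∈ O, w p.1 p.2 • Bmat p.1 p.2 (α p) i j =
      - ((if (i, j) ∈ O then w i j else 0) + (if (j, i) ∈ O then w i j else 0)) := by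
    have h1 : ∀ p ∈ O, w p.1 p.2 • Bmat p.1 p.2 (α p) i j =
        - ((if (i, j) = p then w i j else 0) + (if (j, i) = p then w i j else 0)) := by
      rintro ⟨a, b⟩ hp
      have hab : a ≠ b := (hO _ hp).1.ne
      simp only [Bmat, Matrix.of_apply, Prod.mk.injEq, smul_eq_mul]
      by_cases h1 : i = a
      · subst h1
        have h5 : j ≠ i := hij.symm
        by_cases h2 : j = b
        · subst h2; simp [hij, h5]
        · simp [hij, h5, h2]
      · by_cases h2 : i = b
        · subst h2
          have h5 : j ≠ i := hij.symm
          by_cases h3 : j = a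
          · subst h3; simp [hij, h5, hwsymm j i]
          · simp [hij, h5, h3, h1]
        · simp [h1, h2]
    rw [Finset.sum_congr rfl h1, Finset.sum_neg_distrib, Finset.sum_add_distrib,
      Finset.sum_ite_eq, Finset.sum_ite_eq]
  simp only [paramMatrix, Matrix.add_apply, Matrix.sum_apply, Matrix.smul_apply]
  rw [hsum]
  simp only [signedLaplacian, Matrix.of_apply, if_neg hij, partSgn]
  by_cases hP : P i = P j
  · have h1 : (i, j) ∉ O := fun h => (hO _ h).2 hP
    have h2 : (j, i) ∉ O := fun h => (hO _ h).2 hP.symm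
    by_cases hadj : G.Adj i j
    · simp [hP, h1, h2, hadj]
    · simp [hP, h1, h2, hadj, hw0 i j hadj]
  · by_cases hadj : G.Adj i j
    · have := hOorient i j hadj hP
      by_cases h2 : (j, i) ∈ O
      · have h1 : (i, j) ∉ O := fun h => (this.1 h) h2
        simp [hP, hadj, h1, h2]
      · have h1 : (i, j) ∈ O := this.2 h2
        simp [hP, hadj, h1, h2]
    · simp [hP, hadj, hw0 i j hadj]

/-- The coboundary map of the partition graph. -/
def cobd {ν : ℕ} (P : V → Fin ν) (O : Finset (V × V)) : (Fin ν → ℝ) →ₗ[ℝ] (O → ℝ) where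
  toFun c p := c (P p.1.2) - c (P p.1.1)
  map_add' c d := by ext p; simp; ring
  map_smul' a c := by ext p; simp; ring

lemma cobd_surj (G : SimpleGraph V) (hG : G.Connected) {ν : ℕ} (hν : 1 ≤ ν) (P : V → Fin ν)
    (hPsurj : Function.Surjective P) (O : Finset (V × V))
    (hOorient : ∀ i j, G.Adj i j → P i ≠ P j → ((i, j) ∈ O ↔ (j, i) ∉ O))
    (htree : O.card = ν - 1) : Function.Surjective (cobd P O) := by
  have hker : Module.finrank ℝ (LinearMap.ker (cobd P O)) ≤ 1 := by
    refine finrank_le_one (⟨fun _ => 1, by ext p; simp [cobd]⟩ : LinearMap.ker (cobd P O)) ?_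
    rintro ⟨c, hc⟩
    have hstep : ∀ i j, G.Adj i j → c (P i) = c (P j) := by
      intro i j hij
      by_cases hP : P i = P j
      · rw [hP]
      · by_cases h2 : (j, i) ∈ O
        · have := congrFun (LinearMap.mem_ker.1 hc) ⟨_, h2⟩
          simp [cobd] at this; linarith
        · have := congrFun (LinearMap.mem_ker.1 hc) ⟨_, (hOorient i j hij hP).2 h2⟩
          simp [cobd] at this; linarith
    have hall : ∀ i j, c (P i) = c (P j) := by
      intro i j
      obtain ⟨p⟩ := hG.preconnected i j
      induction p with
      | nil => rfl
      | cons h _ ih => exact (hstep _ _ h).trans ih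
    refine ⟨c ⟨0, hν⟩, ?_⟩
    ext k
    obtain ⟨i, hi⟩ := hPsurj ⟨0, hν⟩
    obtain ⟨j, hj⟩ := hPsurj k
    have := hall i j
    rw [hi, hj] at this
    simpa using this
  have hrn := (cobd P O).finrank_range_add_finrank_ker
  rw [Module.finrank_fin_fun] at hrn
  rw [← LinearMap.range_eq_top]
  apply Submodule.eq_top_of_finrank_eq
  have hle := Submodule.finrank_le (LinearMap.range (cobd P O))
  rw [Module.finrank_fintype_fun_eq_card, Fintype.card_coe, htree] at *
  omega

lemma nodal_eq (G : SimpleGraph V) {ν : ℕ} (P : V → Fin ν) (hPsurj : Function.Surjective P)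
    (hPconn : ∀ k : Fin ν, (G.induce {v | P v = k}).Connected) {ψ : V → ℝ} (hψ : ∀ v, 0 < ψ v) :
    nodalCount G (partSgn P) ψ = ν := by
  have hadj : ∀ i j, (G.deleteEdges (nodalEdges G (partSgn P) ψ)).Adj i j ↔
      G.Adj i j ∧ P i = P j := by
    intro i j
    rw [SimpleGraph.deleteEdges_adj]
    refine and_congr_right fun hij => ?_
    constructor
    · intro h
      by_contra hP
      refine h ⟨i, j, rfl, hij, ?_⟩
      simp only [partSgn, if_neg hP]
      have := mul_pos (hψ i) (hψ j)
      linarith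
    · rintro hP ⟨a, b, he, -, hneg⟩
      have hab : P a = P b := by
        rcases Sym2.eq_iff.1 he with ⟨h1, h2⟩ | ⟨h1, h2⟩
        · rw [← h1, ← h2, hP]
        · rw [← h1, ← h2, hP]
      simp only [partSgn, if_pos hab] at hneg
      have := mul_pos (hψ a) (hψ b)
      linarith
  set H := G.deleteEdges (nodalEdges G (partSgn P) ψ) with hH
  have hreach : ∀ i j, H.Reachable i j → P i = P j := by
    rintro i j ⟨p⟩
    induction p with
    | nil => rfl
    | cons h _ ih => exact ((hadj _ _).1 h).2.trans ih
  let f : H.ConnectedComponent → Fin ν := fun C => C.lift P fun v u p _ => hreach v u ⟨p⟩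
  have hf : Function.Bijective f := by
    constructor
    · intro C D
      refine SimpleGraph.ConnectedComponent.ind₂ (fun v u h => ?_) C D
      have h : P v = P u := h
      rw [SimpleGraph.ConnectedComponent.eq]
      have h1 := (hPconn (P u)).preconnected ⟨v, h⟩ ⟨u, rfl⟩
      let g : G.induce {v | P v = P u} →g H :=
        ⟨Subtype.val, fun {a b} hab => (hadj _ _).2 ⟨hab, a.2.trans b.2.symm⟩⟩
      exact h1.map g
    · intro k
      obtain ⟨v, hv⟩ := hPsurj k
      exact ⟨H.connectedComponentMk v, hv⟩
  rw [nodalCount, ← hH, Nat.card_congr (Equiv.ofBijective f hf), Nat.card_fin]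

lemma block_comm [Fintype V] {ν : ℕ} (P : V → Fin ν) {A : Matrix V V ℝ}
    (hA : ∀ i j, P i ≠ P j → A i j = 0) (c : Fin ν → ℝ) (x : V → ℝ) :
    A *ᵥ (fun v => c (P v) * x v) = fun v => c (P v) * (A *ᵥ x) v := by
  ext i
  simp only [mulVec, dotProduct, Finset.mul_sum]
  refine Finset.sum_congr rfl fun j _ => ?_
  by_cases h : P i = P j
  · rw [h]; ring
  · simp [hA i j h]

lemma L_dot [Fintype V] [DecidableEq V] (G : SimpleGraph V) [DecidableRel G.Adj]
    (w : V → V → ℝ) {ν : ℕ} (P : V → Fin ν) (O : Finset (V × V))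
    (hO : ∀ p ∈ O, G.Adj p.1 p.2 ∧ P p.1 ≠ P p.2) (α : V × V → ℝ) (x y : V → ℝ) :
    y ⬝ᵥ (paramMatrix G w P O α *ᵥ x) = y ⬝ᵥ (signedLaplacian G w (partSgn P) *ᵥ x) +
      ∑ p ∈ O, w p.1 p.2 * (y p.1 * (α p * x p.1 - x p.2) +
        y p.2 * ((α p)⁻¹ * x p.2 - x p.1)) := by
  rw [paramMatrix, add_mulVec, dotProduct_add, sum_mulVec, dotProduct_sum]
  congr 1
  refine Finset.sum_congr rfl fun p hp => ?_
  rw [smul_mulVec, dotProduct_smul, dot_Bmat (hO p hp).1.ne, smul_eq_mul]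

lemma core [Fintype V] [DecidableEq V] (G : SimpleGraph V) [DecidableRel G.Adj]
    (hGconn : G.Connected) (w : V → V → ℝ)
    (hwsymm : ∀ i j, w i j = w j i) (hwpos : ∀ i j, G.Adj i j → 0 < w i j)
    (hw0 : ∀ i j, ¬ G.Adj i j → w i j = 0)
    {ν : ℕ} (hν : 1 ≤ ν) (P : V → Fin ν) (hPsurj : Function.Surjective P)
    (hPconn : ∀ k : Fin ν, (G.induce {v | P v = k}).Connected)
    (O : Finset (V × V))
    (hO : ∀ p ∈ O, G.Adj p.1 p.2 ∧ P p.1 ≠ P p.2)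
    (hOorient : ∀ i j, G.Adj i j → P i ≠ P j → ((i, j) ∈ O ↔ (j, i) ∉ O))
    (htree : O.card = ν - 1)
    (α : V × V → ℝ) (hα : ∀ p ∈ O, 0 < α p)
    (hequi : IsEquipartition G w P O α) :
    ∃ ψ : V → ℝ, (∀ v, 0 < ψ v) ∧
      paramMatrix G w P O α *ᵥ ψ = PartitionEnergy G w P O α • ψ ∧
      (∀ p ∈ O, ψ p.2 = α p * ψ p.1) ∧
      signedLaplacian G w (partSgn P) *ᵥ ψ = PartitionEnergy G w P O α • ψ ∧
      PartitionEnergy G w P O α = nthEigenvalue (signedLaplacian G w (partSgn P)) ν := by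
  have hne : Nonempty (Fin ν) := ⟨⟨0, hν⟩⟩
  set A := paramMatrix G w P O α with hAdef
  set L := signedLaplacian G w (partSgn P) with hLdef
  set E := PartitionEnergy G w P O α with hEdef
  have hwnn : ∀ i j, 0 ≤ w i j := fun i j => by
    by_cases h : G.Adj i j
    · exact (hwpos i j h).le
    · rw [hw0 i j h]
  have hAoff : ∀ {i j : V}, i ≠ j → A i j = if P i = P j then - w i j else 0 := fun hij =>
    pm_off G w hwsymm hw0 P O hO hOorient α hij
  have hAsymm : ∀ i j, A i j = A j i := pm_symm G w hwsymm P O α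
  have hLsymm : ∀ i j, L i j = L j i := sl_symm G w hwsymm P
  have hLH : L.IsHermitian := by ext i j; simp [hLsymm j i]
  have hAblk : ∀ i j, P i ≠ P j → A i j = 0 := fun i j h => by
    rw [hAoff (fun he => h (by rw [he])), if_neg h]
  have hAnp : ∀ i j, i ≠ j → A i j ≤ 0 := fun i j h => by
    rw [hAoff h]; split_ifs
    · linarith [hwnn i j]
    · exact le_rfl
  have hE : ∀ k, lam1Block A P k = E := fun k => by
    have : (fun l => lam1Block A P l) = fun _ => lam1Block A P k := funext fun l => hequi l k
    rw [hEdef, PartitionEnergy, ← hAdef, this, ciSup_const]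
  -- Perron eigenvectors of the blocks
  have hper : ∀ k : Fin ν, ∃ φ : {v : V // P v = k} → ℝ, (∀ v, 0 < φ v) ∧
      blockMatrix A P k *ᵥ φ = E • φ := by
    intro k
    rw [← hE k]
    refine perron (A := blockMatrix A P k) ?_ (G.induce {v | P v = k}) (hPconn k) ?_ ?_
    · ext i j; simp [blockMatrix, hAsymm j i]
    · intro i j hij
      exact hAnp _ _ fun h => hij (Subtype.ext h)
    · intro i j hij
      have hadj : G.Adj i.1 j.1 := hij
      have hP : P i.1 = P j.1 := i.2.trans j.2.symm
      change A i.1 j.1 < 0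
      rw [hAoff hadj.ne, if_pos hP]
      linarith [hwpos _ _ hadj]
  choose φk hφpos hφev using hper
  let φ : V → ℝ := fun v => φk (P v) ⟨v, rfl⟩
  have hφ : ∀ k (v : {v : V // P v = k}), φ v.1 = φk k v := by
    rintro k ⟨v, rfl⟩; rfl
  have hAφ : A *ᵥ φ = E • φ := by
    ext i
    have h1 := congrFun (hφev (P i)) ⟨i, rfl⟩
    simp only [mulVec, dotProduct, blockMatrix, Matrix.submatrix_apply, Pi.smul_apply] at h1 ⊢
    change _ = E • φ i at h1
    rw [← h1]
    have h2 : ∑ j, A i j * φ j = ∑ j ∈ Finset.univ.filter (fun j => P j = P i), A i j * φ j := by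
      rw [Finset.sum_filter]
      refine Finset.sum_congr rfl fun j _ => ?_
      split_ifs with h
      · rfl
      · rw [hAblk i j (Ne.symm h), zero_mul]
    rw [h2, Finset.sum_subtype (p := fun j => P j = P i) _ (by simp)]
    exact Finset.sum_congr rfl fun j _ => by rw [hφ]
  -- rescale along the tree
  obtain ⟨c, hc⟩ := cobd_surj G hGconn hν P hPsurj O hOorient htree
    (fun p => Real.log (α p.1 * φ p.1.1 / φ p.1.2))
  let ψ : V → ℝ := fun v => Real.exp (c (P v)) * φ v
  have hφp : ∀ v, 0 < φ v := fun v => hφpos _ _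
  have hψp : ∀ v, 0 < ψ v := fun v => mul_pos (Real.exp_pos _) (hφp v)
  have hAψ : A *ᵥ ψ = E • ψ := by
    have := block_comm P hAblk (fun k => Real.exp (c k)) φ
    change A *ᵥ ψ = _ at this
    rw [this, hAφ]
    ext v
    simp only [Pi.smul_apply, smul_eq_mul, ψ]; ring
  have hψα : ∀ p ∈ O, ψ p.2 = α p * ψ p.1 := by
    intro p hp
    have h1 : c (P p.2) - c (P p.1) = Real.log (α p * φ p.1 / φ p.2) := congrFun hc ⟨p, hp⟩
    have h2 : Real.exp (c (P p.2)) = Real.exp (c (P p.1)) * (α p * φ p.1 / φ p.2) := by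
      have hpos : 0 < α p * φ p.1 / φ p.2 :=
        div_pos (mul_pos (hα p hp) (hφp _)) (hφp _)
      rw [← Real.exp_log hpos, ← Real.exp_add, ← h1]; congr 1; ring
    have := (hφp p.2).ne'
    simp only [ψ]
    rw [h2]; field_simp
  have hLψ : L *ᵥ ψ = E • ψ := by
    rw [← hAψ]
    ext i
    rw [← single_one_dotProduct i (L *ᵥ ψ), ← single_one_dotProduct i (A *ᵥ ψ),
      L_dot G w P O hO, left_eq_add]
    refine Finset.sum_eq_zero fun p hp => ?_
    have := (hα p hp).ne'
    rw [hψα p hp]; field_simp; ring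
  have hcard : ν ≤ Fintype.card V := by
    simpa using Fintype.card_le_of_surjective P hPsurj
  have hB : ∀ p ∈ O, ∀ x : V → ℝ, w p.1 p.2 * (x p.1 * (α p * x p.1 - x p.2) +
        x p.2 * ((α p)⁻¹ * x p.2 - x p.1)) =
        w p.1 p.2 * ((α p)⁻¹ * (α p * x p.1 - x p.2) ^ 2) := by
    intro p hp x
    have := (hα p hp).ne'
    field_simp; ring
  refine ⟨ψ, hψp, hAψ, hψα, hLψ, le_antisymm ?_ ?_⟩
  · let D : (V → ℝ) →ₗ[ℝ] (O → ℝ) :=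
      { toFun := fun x p => α p.1 * x p.1.1 - x p.1.2
        map_add' := fun x y => by ext p; simp; ring
        map_smul' := fun a x => by ext p; simp; ring }
    obtain ⟨x, hx0, hDx, hx⟩ := exists_low hLH hν hcard D (by simp [htree])
    have h1 := picone hAsymm hAnp hψp hAψ x
    have h2 : x ⬝ᵥ (A *ᵥ x) = x ⬝ᵥ (L *ᵥ x) := by
      rw [L_dot G w P O hO, add_eq_left]
      refine Finset.sum_eq_zero fun p hp => ?_
      have h3 : α p * x p.1 - x p.2 = 0 := congrFun hDx ⟨p, hp⟩
      rw [hB p hp x, h3]; ring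
    rw [h2] at h1
    exact le_of_mul_le_mul_right (h1.trans hx) (dot_pos hx0)
  · let J : (Fin ν → ℝ) →ₗ[ℝ] (V → ℝ) :=
      { toFun := fun y v => y (P v) * ψ v
        map_add' := fun x y => by ext p; simp; ring
        map_smul' := fun a x => by ext p; simp; ring }
    refine nth_le hLH hν hcard J ?_ ?_
    · intro y z hyz
      ext k
      obtain ⟨v, rfl⟩ := hPsurj k
      exact mul_right_cancel₀ (hψp v).ne' (congrFun hyz v)
    · intro y
      have h1 : A *ᵥ J y = E • J y := by
        have := block_comm P hAblk y ψ
        change A *ᵥ J y = _ at this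
        rw [this, hAψ]
        ext v
        simp only [Pi.smul_apply, smul_eq_mul, J, LinearMap.coe_mk, AddHom.coe_mk]; ring
      have h2 := L_dot G w P O hO α (J y) (J y)
      rw [← hAdef, h1, dotProduct_smul, smul_eq_mul] at h2
      rw [h2, ← hLdef]
      have : 0 ≤ ∑ p ∈ O, w p.1 p.2 * (J y p.1 * (α p * J y p.1 - J y p.2) +
        J y p.2 * ((α p)⁻¹ * J y p.2 - J y p.1)) := by
        refine Finset.sum_nonneg fun p hp => ?_
        rw [hB p hp]
        exact mul_nonneg (hwnn _ _) (mul_nonneg (inv_nonneg.2 (hα p hp).le) (sq_nonneg _))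
      linarith

/-- tree partitions. If `|∂P| = ν − 1` (a tree partition) and `(P, α̃)`
is an equipartition with positive parameters, then `α̃` is the unique such parameter vector
and there is an everywhere-positive eigenvector `ψ` of `L^{∂P}` with eigenvalue
`Λ(P, α̃)`, which is the `ν`-th smallest eigenvalue of `L^{∂P}`; `ψ` is Courant-sharp,
having exactly `ν` nodal domains with respect to `σ^{∂P}`. -/
theorem stmt11 [Fintype V] [DecidableEq V] (G : SimpleGraph V) [DecidableRel G.Adj]
    (hGconn : G.Connected) (w : V → V → ℝ)
    (hwsymm : ∀ i j, w i j = w j i) (hwpos : ∀ i j, G.Adj i j → 0 < w i j)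
    (hw0 : ∀ i j, ¬ G.Adj i j → w i j = 0)
    {ν : ℕ} (hν : 1 ≤ ν) (P : V → Fin ν) (hPsurj : Function.Surjective P)
    (hPconn : ∀ k : Fin ν, (G.induce {v | P v = k}).Connected)
    (O : Finset (V × V))
    (hO : ∀ p ∈ O, G.Adj p.1 p.2 ∧ P p.1 ≠ P p.2)
    (hOorient : ∀ i j, G.Adj i j → P i ≠ P j → ((i, j) ∈ O ↔ (j, i) ∉ O))
    (htree : O.card = ν - 1)
    (αt : V × V → ℝ) (hαt : ∀ p ∈ O, 0 < αt p)
    (hequi : IsEquipartition G w P O αt) :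
    (∀ α' : V × V → ℝ, (∀ p ∈ O, 0 < α' p) → IsEquipartition G w P O α' →
      ∀ p ∈ O, α' p = αt p) ∧
    ∃ ψ : V → ℝ, (∀ v, 0 < ψ v) ∧
      (signedLaplacian G w (partSgn P)).mulVec ψ = PartitionEnergy G w P O αt • ψ ∧
      PartitionEnergy G w P O αt = nthEigenvalue (signedLaplacian G w (partSgn P)) ν ∧
      nodalCount G (partSgn P) ψ = ν := by

  obtain ⟨ψ, hψp, hAψ, hψα, hLψ, hEn⟩ := core G hGconn w hwsymm hwpos hw0 hν P hPsurj hPconn O hO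
    hOorient htree αt hαt hequi
  refine ⟨?_, ψ, hψp, hLψ, hEn, nodal_eq G P hPsurj hPconn hψp⟩
  intro α' hα' hequi'
  obtain ⟨ψ', hψp', -, hψα', hLψ', hEn'⟩ := core G hGconn w hwsymm hwpos hw0 hν P hPsurj hPconn
    O hO hOorient htree α' hα' hequi'
  rw [hEn', ← hEn] at hLψ'
  have hAblk : ∀ i j, P i ≠ P j → paramMatrix G w P O αt i j = 0 := fun i j h => by
    rw [pm_off G w hwsymm hw0 P O hO hOorient αt (fun he => h (by rw [he])), if_neg h]
  obtain ⟨c, hc⟩ := cobd_surj G hGconn hν P hPsurj O hOorient htree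
    (fun p => ψ p.1.1 * ψ' p.1.2 - ψ p.1.2 * ψ' p.1.1)
  set y : V → ℝ := fun v => c (P v) * ψ v with hy
  have hAy : paramMatrix G w P O αt *ᵥ y = PartitionEnergy G w P O αt • y := by
    rw [hy, block_comm P hAblk c ψ, hAψ]
    ext v
    simp only [Pi.smul_apply, smul_eq_mul]; ring
  have hT : (paramMatrix G w P O αt)ᵀ = paramMatrix G w P O αt := by
    ext i j; exact pm_symm G w hwsymm P O αt j i
  have h1 := L_dot G w P O hO αt ψ' y
  rw [dotProduct_mulVec, ← mulVec_transpose, hT, hAy, hLψ', smul_dotProduct, dotProduct_smul] at h1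
  have h2 : ∑ p ∈ O, w p.1 p.2 * (ψ p.1 * ψ' p.2 - ψ p.2 * ψ' p.1) ^ 2 = 0 := by
    have h3 := (left_eq_add.1 h1)
    rw [← h3]
    refine Finset.sum_congr rfl fun p hp => ?_
    have h4 : c (P p.2) - c (P p.1) = ψ p.1 * ψ' p.2 - ψ p.2 * ψ' p.1 := congrFun hc ⟨p, hp⟩
    have h5 := (hαt p hp).ne'
    rw [sq]
    nth_rw 1 [← h4]
    simp only [hy]
    rw [hψα p hp]
    field_simp
    ring
  intro p hp
  have h3 := (Finset.sum_eq_zero_iff_of_nonneg (fun p hp =>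
    mul_nonneg (hwpos _ _ (hO p hp).1).le (sq_nonneg _))).1 h2 p hp
  have h4 : ψ p.1 * ψ' p.2 - ψ p.2 * ψ' p.1 = 0 := by
    rcases mul_eq_zero.1 h3 with h | h
    · exact absurd h (hwpos _ _ (hO p hp).1).ne'
    · exact pow_eq_zero_iff (two_ne_zero) |>.1 h
  rw [hψα p hp, hψα' p hp] at h4
  have h5 : (ψ p.1 * ψ' p.1) * (α' p - αt p) = 0 := by linear_combination h4
  rcases mul_eq_zero.1 h5 with h | h
  · exact absurd h (mul_pos (hψp _) (hψp' _)).ne'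
  · linarith

end
end

section
/- Let Γ ⊆ E, let P be a ν-partition of G with boundary ∂P, and suppose there exists Γ̃ ⊆ ∂P such that σ^Γ is switching equivalent to σ^{Γ̃}. If λ_ν(Γ) = Λ(P, α) for some α ∈ ℝ^{∂P} with all entries positive, then there exists an eigenvector ψ of L^Γ with eigenvalue λ_ν(Γ) such that ψ_i ≠ 0 for all i ∈ V and the nodal set of ψ with respect to σ^Γ equals ∂P (i.e. P is the nodal partition of ψ). -/
open Matrix Finset

noncomputable section

variable {V : Type*}

open Classical in
/-- The signature `σ^Γ` associated to a set of edges `Γ`: `-1` on `Γ`, `+1` elsewhere. -/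
def sgnOfEdgeSet (Γ : Set (Sym2 V)) (i j : V) : ℝ :=
  if s(i, j) ∈ Γ then -1 else 1

/-- Two signatures on `G` are switching equivalent. -/
def SwitchingEquiv (G : SimpleGraph V) (σ σ' : V → V → ℝ) : Prop :=
  ∃ τ : V → ℝ, (∀ v, τ v = 1 ∨ τ v = -1) ∧
    ∀ i j, G.Adj i j → σ' i j = τ i * σ i j * τ j


/-! ### Spectral helper lemmas -/

lemma aux_spectral {W : Type*} [Fintype W] [DecidableEq W] (A : Matrix W W ℝ)
    (hA : A.IsHermitian) : ∃ b : W → W → ℝ, (∀ i j, b i ⬝ᵥ b j = if i = j then 1 else 0) ∧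
      (∀ i, A *ᵥ b i = hA.eigenvalues i • b i) ∧
      (∀ u : W → ℝ, u = ∑ i, (b i ⬝ᵥ u) • b i) := by
  refine ⟨fun i => (hA.eigenvectorBasis i).ofLp, ?_, ?_, ?_⟩
  · intro i j
    have h := orthonormal_iff_ite.1 hA.eigenvectorBasis.orthonormal i j
    rw [← h, EuclideanSpace.inner_eq_star_dotProduct]
    simp [dotProduct_comm]
  · intro i
    exact hA.mulVec_eigenvectorBasis i
  · intro u
    have h := hA.eigenvectorBasis.sum_repr' (WithLp.toLp 2 u)
    have h2 := congrArg WithLp.ofLp h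
    simp only [WithLp.ofLp_sum, WithLp.ofLp_smul, EuclideanSpace.inner_eq_star_dotProduct] at h2
    simp only [star_trivial] at h2
    conv_lhs => rw [← h2]
    exact Finset.sum_congr rfl fun i _ => by rw [dotProduct_comm]

lemma aux_form {W : Type*} [Fintype W] [DecidableEq W] (A : Matrix W W ℝ) (μ : W → ℝ)
    (b : W → W → ℝ) (hb : ∀ i j, b i ⬝ᵥ b j = if i = j then 1 else 0)
    (hA : ∀ i, A *ᵥ b i = μ i • b i) (hu : ∀ u : W → ℝ, u = ∑ i, (b i ⬝ᵥ u) • b i)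
    (u : W → ℝ) : A *ᵥ u = ∑ i, (μ i * (b i ⬝ᵥ u)) • b i ∧
      u ⬝ᵥ (A *ᵥ u) = ∑ i, μ i * (b i ⬝ᵥ u) ^ 2 ∧ u ⬝ᵥ u = ∑ i, (b i ⬝ᵥ u) ^ 2 := by
  have h1 : A *ᵥ u = ∑ i, (μ i * (b i ⬝ᵥ u)) • b i := by
    conv_lhs => rw [hu u]
    rw [Matrix.mulVec_sum]
    refine Finset.sum_congr rfl fun i _ => ?_
    rw [Matrix.mulVec_smul, hA, smul_smul, mul_comm]
  refine ⟨h1, ?_, ?_⟩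
  · rw [h1, dotProduct_sum]
    refine Finset.sum_congr rfl fun i _ => ?_
    rw [dotProduct_smul, dotProduct_comm, smul_eq_mul]; ring
  · conv_lhs => rw [hu u]
    rw [sum_dotProduct]
    refine Finset.sum_congr rfl fun i _ => ?_
    rw [smul_dotProduct, ← hu u, smul_eq_mul]; ring

lemma aux_first {W : Type*} [Fintype W] [DecidableEq W] [Nonempty W] (A : Matrix W W ℝ)
    (hA : A.IsHermitian) : (∃ f : W → ℝ, f ≠ 0 ∧ A *ᵥ f = nthEigenvalue A 1 • f) ∧
      ∀ u : W → ℝ, nthEigenvalue A 1 * (u ⬝ᵥ u) ≤ u ⬝ᵥ (A *ᵥ u) := by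
  obtain ⟨b, hb, hbA, hbu⟩ := aux_spectral A hA
  have hc : A.IsHermitian ∧ 1 - 1 < Fintype.card W := ⟨hA, by simpa using Fintype.card_pos⟩
  set f : Fin (Fintype.card W) → ℝ := fun i => hc.1.eigenvalues ((Fintype.equivFin W).symm i)
    with hf
  have hn : nthEigenvalue A 1 = f (Tuple.sort f ⟨0, hc.2⟩) := by
    unfold nthEigenvalue
    rw [dif_pos hc]
  have hmin : ∀ i, nthEigenvalue A 1 ≤ hA.eigenvalues i := by
    intro i
    have h := Tuple.monotone_sort f
      (show (⟨0, hc.2⟩ : Fin _) ≤ (Tuple.sort f).symm (Fintype.equivFin W i) from Nat.zero_le _)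
    simp only [Function.comp_apply, Equiv.apply_symm_apply] at h
    rw [hn]
    refine h.trans (le_of_eq ?_)
    simp [hf]
  refine ⟨⟨b ((Fintype.equivFin W).symm (Tuple.sort f ⟨0, hc.2⟩)), ?_, ?_⟩, ?_⟩
  · intro h0
    have := hb ((Fintype.equivFin W).symm (Tuple.sort f ⟨0, hc.2⟩))
      ((Fintype.equivFin W).symm (Tuple.sort f ⟨0, hc.2⟩))
    rw [h0] at this
    simp at this
  · rw [hbA, hn]
  · intro u
    obtain ⟨-, h2, h3⟩ := aux_form A _ b hb hbA hbu u
    rw [h2, h3, Finset.mul_sum]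
    exact Finset.sum_le_sum fun i _ => mul_le_mul_of_nonneg_right (hmin i) (sq_nonneg _)

lemma aux_minmax {W : Type*} [Fintype W] [DecidableEq W] (A : Matrix W W ℝ)
    (hA : A.IsHermitian) {n : ℕ} (hn : 0 < n) (hnc : n ≤ Fintype.card W)
    (Φ : (Fin n → ℝ) →ₗ[ℝ] (W → ℝ))
    (hΦ : ∀ c, Φ c ⬝ᵥ (A *ᵥ Φ c) ≤ nthEigenvalue A n * (Φ c ⬝ᵥ Φ c)) :
    ∃ c, c ≠ 0 ∧ A *ᵥ Φ c = nthEigenvalue A n • Φ c := by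
  obtain ⟨b, hb, hbA, hbu⟩ := aux_spectral A hA
  have hc : A.IsHermitian ∧ n - 1 < Fintype.card W := ⟨hA, by omega⟩
  set f : Fin (Fintype.card W) → ℝ := fun i => hc.1.eigenvalues ((Fintype.equivFin W).symm i)
    with hf
  have hnn : nthEigenvalue A n = f (Tuple.sort f ⟨n - 1, hc.2⟩) := by
    unfold nthEigenvalue
    rw [dif_pos hc]
  set l := nthEigenvalue A n with hl
  let e : Fin (Fintype.card W) → W := fun i => (Fintype.equivFin W).symm (Tuple.sort f i)
  have he : ∀ w, ∃ i, e i = w := fun w =>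
    ⟨(Tuple.sort f).symm (Fintype.equivFin W w), by simp [e]⟩
  -- orthogonality conditions
  let T : (Fin n → ℝ) →ₗ[ℝ] (Fin (n - 1) → ℝ) :=
    { toFun := fun c k => b (e ⟨k, by omega⟩) ⬝ᵥ Φ c
      map_add' := by intro x y; ext k; simp [dotProduct_add]
      map_smul' := by intro r x; ext k; simp [dotProduct_smul] }
  obtain ⟨c, hcT, hc0⟩ : ∃ c, T c = 0 ∧ c ≠ 0 := by
    have h := LinearMap.ker_ne_bot_of_finrank_lt (f := T) (by simp; omega)
    obtain ⟨c, h1, h2⟩ := (Submodule.ne_bot_iff _).1 h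
    exact ⟨c, h1, h2⟩
  refine ⟨c, hc0, ?_⟩
  obtain ⟨h1, h2, h3⟩ := aux_form A _ b hb hbA hbu (Φ c)
  have hle := hΦ c
  rw [h2, h3, Finset.mul_sum] at hle
  have hnonneg : ∀ i, 0 ≤ (hA.eigenvalues i - l) * (b i ⬝ᵥ Φ c) ^ 2 := by
    intro w
    obtain ⟨i, rfl⟩ := he w
    by_cases hi : i.1 < n - 1
    · have : b (e i) ⬝ᵥ Φ c = 0 := congrFun hcT ⟨i.1, hi⟩
      rw [this]; simp
    · refine mul_nonneg ?_ (sq_nonneg _)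
      have h := Tuple.monotone_sort f
        (show (⟨n - 1, hc.2⟩ : Fin _) ≤ i from not_lt.1 hi)
      rw [sub_nonneg, hnn]
      exact h
  have hzero : ∀ i, (hA.eigenvalues i - l) * (b i ⬝ᵥ Φ c) ^ 2 = 0 := by
    have hs : ∑ i, (hA.eigenvalues i - l) * (b i ⬝ᵥ Φ c) ^ 2 = 0 := by
      refine le_antisymm ?_ (Finset.sum_nonneg fun i _ => hnonneg i)
      simp only [sub_mul, Finset.sum_sub_distrib]
      linarith
    intro i
    exact (Finset.sum_eq_zero_iff_of_nonneg fun i _ => hnonneg i).1 hs i (Finset.mem_univ i)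
  rw [h1]
  conv_rhs => rw [hbu (Φ c), Finset.smul_sum]
  refine Finset.sum_congr rfl fun i _ => ?_
  rw [smul_smul]
  rcases mul_eq_zero.1 (hzero i) with h | h
  · rw [sub_eq_zero.1 h]
  · rw [pow_eq_zero_iff (by norm_num)] at h
    rw [h]; simp

lemma aux_min_eig {W : Type*} [Fintype W] [DecidableEq W] (A : Matrix W W ℝ)
    (hA : A.IsHermitian) (l : ℝ) (hl : ∀ u : W → ℝ, l * (u ⬝ᵥ u) ≤ u ⬝ᵥ (A *ᵥ u))
    (g : W → ℝ) (hg : g ⬝ᵥ (A *ᵥ g) ≤ l * (g ⬝ᵥ g)) : A *ᵥ g = l • g := by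
  have hB : (A - l • (1 : Matrix W W ℝ)).PosSemidef := by
    refine Matrix.PosSemidef.of_dotProduct_mulVec_nonneg ?_ ?_
    · refine hA.sub ?_
      simp [Matrix.IsHermitian]
    · intro x
      simp only [star_trivial, Matrix.sub_mulVec, Matrix.smul_mulVec, Matrix.one_mulVec,
        dotProduct_sub, dotProduct_smul, smul_eq_mul]
      linarith [hl x]
  have h := (hB.dotProduct_mulVec_zero_iff g).1 (by
    simp only [star_trivial, Matrix.sub_mulVec, Matrix.smul_mulVec, Matrix.one_mulVec,
        dotProduct_sub, dotProduct_smul, smul_eq_mul]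
    linarith [hl g])
  simpa only [Matrix.sub_mulVec, Matrix.smul_mulVec, Matrix.one_mulVec, sub_eq_zero] using h

lemma aux_conn {W : Type*} {H : SimpleGraph W} (hH : H.Connected) (p : W → Prop)
    (step : ∀ i j, H.Adj i j → p i → p j) {i : W} (hi : p i) (j : W) : p j := by
  obtain ⟨q⟩ := hH.preconnected i j
  induction q with
  | nil => exact hi
  | cons h _ ih => exact ih (step _ _ h hi)

lemma aux_perron {W : Type*} [Fintype W] [DecidableEq W] (H : SimpleGraph W)
    (hH : H.Connected) (A : Matrix W W ℝ) (hA : A.IsHermitian)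
    (hoff : ∀ i j, i ≠ j → A i j ≤ 0) (hadj : ∀ i j, H.Adj i j → A i j < 0) :
    ∃ g : W → ℝ, (∀ i, 0 < g i) ∧ A *ᵥ g = nthEigenvalue A 1 • g := by
  have := hH.nonempty
  obtain ⟨⟨f, hf0, hf⟩, hmin⟩ := aux_first A hA
  set l := nthEigenvalue A 1
  let g : W → ℝ := fun i => |f i|
  have hg0 : ∀ i, 0 ≤ g i := fun i => abs_nonneg _
  have hgg : g ⬝ᵥ g = f ⬝ᵥ f := by
    simp [dotProduct, g, abs_mul_abs_self]
  have hgA : g ⬝ᵥ (A *ᵥ g) ≤ l * (g ⬝ᵥ g) := by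
    have : f ⬝ᵥ (A *ᵥ f) = l * (g ⬝ᵥ g) := by rw [hf, dotProduct_smul, hgg, smul_eq_mul]
    rw [← this]
    simp only [dotProduct, Matrix.mulVec, Finset.mul_sum]
    refine Finset.sum_le_sum fun i _ => Finset.sum_le_sum fun j _ => ?_
    by_cases hij : i = j
    · subst hij
      have := abs_mul_abs_self (f i)
      simp only [g]
      exact le_of_eq (by linear_combination A i i * this)
    · have h1 := hoff i j hij
      have h2 : f i * f j ≤ |f i| * |f j| := by rw [← abs_mul]; exact le_abs_self _
      simp only [g]
      nlinarith
  have hge := aux_min_eig A hA l hmin g hgA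
  refine ⟨g, fun i => ?_, hge⟩
  refine lt_of_le_of_ne (hg0 i) fun hi => ?_
  apply hf0
  have : ∀ j, g j = 0 := by
    refine aux_conn hH (fun j => g j = 0) ?_ hi.symm
    intro i j hij hgi
    have h1 := congrFun hge i
    simp only [Matrix.mulVec, dotProduct, Pi.smul_apply, hgi, smul_zero] at h1
    have h2 : ∀ k ∈ Finset.univ, A i k * g k ≤ 0 := by
      intro k _
      by_cases hk : i = k
      · subst hk; rw [hgi]; simp
      · exact mul_nonpos_of_nonpos_of_nonneg (hoff i k hk) (hg0 k)
    have h3 := (Finset.sum_eq_zero_iff_of_nonpos h2).1 h1 j (Finset.mem_univ j)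
    rcases mul_eq_zero.1 h3 with h | h
    · exact absurd h (hadj i j hij).ne
    · exact h
  funext j
  exact abs_eq_zero.1 (this j)

/-! ### Graph helper lemmas -/

lemma aux_qf {V : Type*} [Fintype V] [DecidableEq V] (G : SimpleGraph V) [DecidableRel G.Adj]
    (w σ : V → V → ℝ) (u : V → ℝ) :
    u ⬝ᵥ (signedLaplacian G w σ *ᵥ u) = ∑ i, (∑ k, if G.Adj i k then w i k else 0) * u i ^ 2
      - ∑ i, ∑ j, if G.Adj i j then σ i j * w i j * u i * u j else 0 := by
  rw [← Finset.sum_sub_distrib]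
  simp only [dotProduct, Matrix.mulVec]
  refine Finset.sum_congr rfl fun i _ => ?_
  set d := ∑ k, if G.Adj i k then w i k else 0 with hd
  have h : ∀ j, signedLaplacian G w σ i j * u j
      = (if i = j then d * u j else 0) - (if G.Adj i j then σ i j * w i j * u j else 0) := by
    intro j
    simp only [signedLaplacian, Matrix.of_apply]
    by_cases hij : i = j
    · subst hij
      simp [hd]
    · simp only [hij, if_false]
      split_ifs <;> ring
  simp only [h, Finset.sum_sub_distrib, Finset.sum_ite_eq, Finset.mem_univ, if_true, mul_sub,
    Finset.mul_sum]
  congr 1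
  · ring
  · refine Finset.sum_congr rfl fun j _ => ?_
    split_ifs <;> ring

lemma aux_herm {V : Type*} [Fintype V] [DecidableEq V] (G : SimpleGraph V) [DecidableRel G.Adj]
    (w σ : V → V → ℝ) (hw : ∀ i j, w i j = w j i) (hσ : ∀ i j, σ i j = σ j i) :
    (signedLaplacian G w σ).IsHermitian := by
  refine Matrix.IsHermitian.ext fun i j => ?_
  simp only [signedLaplacian, Matrix.of_apply, star_trivial]
  by_cases hij : i = j
  · subst hij; rfl
  · simp only [hij, Ne.symm hij, if_false, G.adj_comm j i, hw j i, hσ j i]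

lemma aux_bform {V : Type*} [Fintype V] [DecidableEq V] (i j : V) (hij : i ≠ j) (a : ℝ)
    (u : V → ℝ) :
    u ⬝ᵥ (Bmat i j a *ᵥ u) = a * u i ^ 2 + a⁻¹ * u j ^ 2 - 2 * u i * u j := by
  have h : ∀ x y, Bmat i j a x y * u y =
      (if y = i then (if x = i then a * u i else 0) - (if x = j then u i else 0) else 0) +
      (if y = j then (if x = j then a⁻¹ * u j else 0) - (if x = i then u j else 0) else 0) := by
    intro x y
    simp only [Bmat, Matrix.of_apply]
    by_cases hx : x = i <;> by_cases hx' : x = j <;> by_cases hy : y = i <;>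
      by_cases hy' : y = j <;> simp_all
  simp only [dotProduct, Matrix.mulVec, h, Finset.sum_add_distrib, Finset.sum_ite_eq',
    Finset.mem_univ, if_true, mul_add, mul_sub, Finset.sum_sub_distrib, mul_ite, mul_zero]
  ring

lemma aux_boundary_sum {V : Type*} [Fintype V] [DecidableEq V] (O : Finset (V × V))
    (F : V → V → ℝ) (hF : ∀ i j, F i j = F j i)
    (hO1 : ∀ i j, (i, j) ∈ O → (j, i) ∉ O)
    (hO2 : ∀ i j, F i j ≠ 0 → (i, j) ∈ O ∨ (j, i) ∈ O) :
    ∑ i, ∑ j, F i j = 2 * ∑ p ∈ O, F p.1 p.2 := by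
  have h1 : ∀ i j, F i j = (if (i, j) ∈ O then F i j else 0) + (if (j, i) ∈ O then F j i else 0) := by
    intro i j
    by_cases h : (i, j) ∈ O
    · simp [h, hO1 i j h]
    · by_cases h' : (j, i) ∈ O
      · simp [h, h', hF i j]
      · simp only [h, h', if_false, add_zero]
        by_contra h0
        exact (hO2 i j h0).elim h h'
  have h2 : ∑ i, ∑ j, (if (i, j) ∈ O then F i j else 0) = ∑ p ∈ O, F p.1 p.2 := by
    rw [← Fintype.sum_prod_type' (f := fun i j => if (i, j) ∈ O then F i j else 0)]
    simp [Finset.sum_ite_mem]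
  have h3 : ∑ i, ∑ j, (if (j, i) ∈ O then F j i else 0) = ∑ p ∈ O, F p.1 p.2 := by
    rw [Finset.sum_comm]; exact h2
  calc ∑ i, ∑ j, F i j = ∑ i, ∑ j, ((if (i, j) ∈ O then F i j else 0)
        + (if (j, i) ∈ O then F j i else 0)) :=
        Finset.sum_congr rfl fun i _ => Finset.sum_congr rfl fun j _ => h1 i j
    _ = _ := by simp only [Finset.sum_add_distrib]; rw [h2, h3]; ring

lemma aux_paramMatrix_apply {V : Type*} [Fintype V] [DecidableEq V] (G : SimpleGraph V)
    [DecidableRel G.Adj] (w : V → V → ℝ) (hwsymm : ∀ i j, w i j = w j i)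
    {ν : ℕ} (P : V → Fin ν) (O : Finset (V × V))
    (hO : ∀ p ∈ O, G.Adj p.1 p.2 ∧ P p.1 ≠ P p.2)
    (hOorient : ∀ i j, G.Adj i j → P i ≠ P j → ((i, j) ∈ O ↔ (j, i) ∉ O))
    (α : V × V → ℝ) (i j : V) (hij : i ≠ j) :
    paramMatrix G w P O α i j = if G.Adj i j ∧ P i = P j then - w i j else 0 := by
  have hB : ∀ p ∈ O, (w p.1 p.2 • Bmat p.1 p.2 (α p)) i j =
      (if p = (i, j) then - w i j else 0) + (if p = (j, i) then - w i j else 0) := by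
    rintro ⟨x, y⟩ hp
    have hxy : x ≠ y := (hO _ hp).1.ne
    simp only [Bmat, Matrix.smul_apply, Matrix.of_apply, Prod.mk.injEq, smul_eq_mul]
    have h1 : ¬ (i = x ∧ j = x) := fun h => hij (h.1.trans h.2.symm)
    have h2 : ¬ (i = y ∧ j = y) := fun h => hij (h.1.trans h.2.symm)
    simp only [h1, h2, if_false]
    by_cases hc : x = i ∧ y = j
    · obtain ⟨rfl, rfl⟩ := hc
      simp [hxy]
    · by_cases hc' : x = j ∧ y = i
      · obtain ⟨rfl, rfl⟩ := hc'
        simp [hxy, hwsymm x y]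
      · rw [if_neg hc, if_neg hc', if_neg]
        · simp
        · rintro (⟨h, h'⟩ | ⟨h, h'⟩)
          · exact hc ⟨h.symm, h'.symm⟩
          · exact hc' ⟨h'.symm, h.symm⟩
  rw [paramMatrix, Matrix.add_apply, Matrix.sum_apply, Finset.sum_congr rfl hB,
    Finset.sum_add_distrib, Finset.sum_ite_eq', Finset.sum_ite_eq']
  simp only [signedLaplacian, Matrix.of_apply, hij, if_false, partSgn]
  by_cases ha : G.Adj i j
  · by_cases hP : P i = P j
    · have h1 : (i, j) ∉ O := fun h => (hO _ h).2 hP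
      have h2 : (j, i) ∉ O := fun h => (hO _ h).2 hP.symm
      simp [ha, hP, h1, h2]
    · have h := hOorient i j ha hP
      by_cases h1 : (i, j) ∈ O
      · simp [ha, hP, h1, h.1 h1]
      · have h2 : (j, i) ∈ O := by
          by_contra h2; exact h1 (h.2 h2)
        simp [ha, hP, h1, h2]
  · have h1 : (i, j) ∉ O := fun h => ha (hO _ h).1
    have h2 : (j, i) ∉ O := fun h => ha (hO _ h).1.symm
    simp [ha, h1, h2]

lemma aux_diff {V : Type*} [Fintype V] [DecidableEq V] (G : SimpleGraph V)
    [DecidableRel G.Adj] (w : V → V → ℝ) (hwsymm : ∀ i j, w i j = w j i)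
    {ν : ℕ} (P : V → Fin ν) (O : Finset (V × V))
    (hO : ∀ p ∈ O, G.Adj p.1 p.2 ∧ P p.1 ≠ P p.2)
    (hOorient : ∀ i j, G.Adj i j → P i ≠ P j → ((i, j) ∈ O ↔ (j, i) ∉ O))
    (α : V × V → ℝ) (hαpos : ∀ p ∈ O, 0 < α p) (σ s : V → V → ℝ) (τ : V → ℝ)
    (hτ : ∀ v, τ v = 1 ∨ τ v = -1) (hs : ∀ i j, G.Adj i j → s i j = τ i * σ i j * τ j)
    (hs1 : ∀ i j, s i j = 1 ∨ s i j = -1) (hssymm : ∀ i j, s i j = s j i)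
    (hsP : ∀ i j, G.Adj i j → P i = P j → s i j = 1) (u : V → ℝ) :
    u ⬝ᵥ (paramMatrix G w P O α *ᵥ u)
      = (fun v => τ v * u v) ⬝ᵥ (signedLaplacian G w σ *ᵥ (fun v => τ v * u v))
        + ∑ p ∈ O, w p.1 p.2 * α p * (u p.1 + s p.1 p.2 * u p.2 / α p) ^ 2 := by
  have hτ2 : ∀ v, τ v ^ 2 = 1 := fun v => by rcases hτ v with h | h <;> rw [h] <;> norm_num
  have hM : u ⬝ᵥ (paramMatrix G w P O α *ᵥ u) = u ⬝ᵥ (signedLaplacian G w (partSgn P) *ᵥ u)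
      + ∑ p ∈ O, w p.1 p.2 * (α p * u p.1 ^ 2 + (α p)⁻¹ * u p.2 ^ 2 - 2 * u p.1 * u p.2) := by
    rw [paramMatrix, Matrix.add_mulVec, dotProduct_add, Matrix.sum_mulVec, dotProduct_sum]
    congr 1
    refine Finset.sum_congr rfl fun p hp => ?_
    rw [Matrix.smul_mulVec, dotProduct_smul, aux_bform _ _ (hO p hp).1.ne, smul_eq_mul]
  have hb := aux_boundary_sum O
    (fun i j => if G.Adj i j then (s i j - partSgn P i j) * w i j * u i * u j else 0)
    (by
      intro i j
      simp only [G.adj_comm j i, hssymm j i, hwsymm j i]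
      have : partSgn P j i = partSgn P i j := by simp only [partSgn, eq_comm]
      rw [this]
      split_ifs <;> ring)
    (fun i j h => (hOorient i j (hO _ h).1 (hO _ h).2).1 h)
    (by
      intro i j h
      by_cases ha : G.Adj i j
      · by_cases hP : P i = P j
        · simp [partSgn, hP, hsP i j ha hP] at h
        · by_cases h1 : (i, j) ∈ O
          · exact Or.inl h1
          · right
            by_contra h2
            exact h1 ((hOorient i j ha hP).2 h2)
      · simp [ha] at h)
  have hsum : ∑ p ∈ O, w p.1 p.2 * α p * (u p.1 + s p.1 p.2 * u p.2 / α p) ^ 2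
      = 2 * (∑ p ∈ O, if G.Adj p.1 p.2 then
          (s p.1 p.2 - partSgn P p.1 p.2) * w p.1 p.2 * u p.1 * u p.2 else 0)
      + ∑ p ∈ O, w p.1 p.2 * (α p * u p.1 ^ 2 + (α p)⁻¹ * u p.2 ^ 2 - 2 * u p.1 * u p.2) := by
    rw [Finset.mul_sum, ← Finset.sum_add_distrib]
    refine Finset.sum_congr rfl fun p hp => ?_
    rw [if_pos (hO p hp).1]
    have hp1 : partSgn P p.1 p.2 = -1 := by simp [partSgn, (hO p hp).2]
    have hα := (hαpos p hp).ne'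
    have hs2 : s p.1 p.2 ^ 2 = 1 := by
      rcases hs1 p.1 p.2 with h | h <;> rw [h] <;> norm_num
    rw [hp1]
    field_simp
    linear_combination (w p.1 p.2 * u p.2 ^ 2) * hs2
  rw [hM, hsum, ← hb, aux_qf, aux_qf]
  have e1 : ∀ i, (τ i * u i) ^ 2 = u i ^ 2 := fun i => by rw [mul_pow, hτ2, one_mul]
  have e2 : ∀ i j, (if G.Adj i j then σ i j * w i j * (τ i * u i) * (τ j * u j) else 0)
      = (if G.Adj i j then s i j * w i j * u i * u j else 0) := by
    intro i j
    split_ifs with h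
    · rw [hs i j h]; ring
    · rfl
  have e3 : ∀ i j, (if G.Adj i j then (s i j - partSgn P i j) * w i j * u i * u j else 0)
      = (if G.Adj i j then s i j * w i j * u i * u j else 0)
        - (if G.Adj i j then partSgn P i j * w i j * u i * u j else 0) := by
    intro i j
    split_ifs <;> ring
  simp only [e1, e2, e3, Finset.sum_sub_distrib]
  ring

/-- equality case. If `Γ̃ ⊆ ∂P` with `σ^Γ` switching equivalent to
`σ^{Γ̃}` and `λ_ν(Γ) = Λ(P, α)` for some positive `α`, then there is a nowhere-zero
eigenvector `ψ` of `L^Γ` with eigenvalue `λ_ν(Γ)` whose nodal set with respect to `σ^Γ` is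
exactly `∂P`, i.e. `P` is the nodal partition of `ψ`. -/
theorem stmt17 [Fintype V] [DecidableEq V] (G : SimpleGraph V) [DecidableRel G.Adj]
    (hGconn : G.Connected) (w : V → V → ℝ)
    (hwsymm : ∀ i j, w i j = w j i) (hwpos : ∀ i j, G.Adj i j → 0 < w i j)
    (hw0 : ∀ i j, ¬ G.Adj i j → w i j = 0)
    (Γ : Set (Sym2 V)) (hΓ : Γ ⊆ G.edgeSet)
    {ν : ℕ} (P : V → Fin ν) (hPsurj : Function.Surjective P)
    (hPconn : ∀ k : Fin ν, (G.induce {v | P v = k}).Connected)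
    (O : Finset (V × V))
    (hO : ∀ p ∈ O, G.Adj p.1 p.2 ∧ P p.1 ≠ P p.2)
    (hOorient : ∀ i j, G.Adj i j → P i ≠ P j → ((i, j) ∈ O ↔ (j, i) ∉ O))
    (Γt : Set (Sym2 V))
    (hΓt : ∀ e ∈ Γt, ∃ i j, e = s(i, j) ∧ G.Adj i j ∧ P i ≠ P j)
    (hswitch : SwitchingEquiv G (sgnOfEdgeSet Γ) (sgnOfEdgeSet Γt))
    (α : V × V → ℝ) (hαpos : ∀ p ∈ O, 0 < α p)
    (heq : nthEigenvalue (signedLaplacian G w (sgnOfEdgeSet Γ)) ν = PartitionEnergy G w P O α) :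
    ∃ ψ : V → ℝ,
      (signedLaplacian G w (sgnOfEdgeSet Γ)).mulVec ψ
          = nthEigenvalue (signedLaplacian G w (sgnOfEdgeSet Γ)) ν • ψ ∧
      ψ ≠ 0 ∧ (∀ v, ψ v ≠ 0) ∧
      nodalEdges G (sgnOfEdgeSet Γ) ψ
          = {e | ∃ i j, e = s(i, j) ∧ G.Adj i j ∧ P i ≠ P j} := by
  obtain ⟨τ, hτ, hs⟩ := hswitch
  have hτ0 : ∀ v, τ v ≠ 0 := fun v => by rcases hτ v with h | h <;> rw [h] <;> norm_num
  have hτ2 : ∀ v, τ v * τ v = 1 := fun v => by rcases hτ v with h | h <;> rw [h] <;> norm_num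
  have hsym : ∀ (Δ : Set (Sym2 V)) (i j : V), sgnOfEdgeSet Δ i j = sgnOfEdgeSet Δ j i := by
    intro Δ i j
    unfold sgnOfEdgeSet
    rw [show s(i, j) = s(j, i) from Sym2.eq_swap]
  have hs1 : ∀ i j, sgnOfEdgeSet Γt i j = 1 ∨ sgnOfEdgeSet Γt i j = -1 := by
    intro i j
    unfold sgnOfEdgeSet
    split_ifs <;> simp
  have hsP : ∀ i j, G.Adj i j → P i = P j → sgnOfEdgeSet Γt i j = 1 := by
    intro i j _ hP
    unfold sgnOfEdgeSet
    rw [if_neg]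
    intro h
    obtain ⟨x, y, he, -, hne⟩ := hΓt _ h
    rcases Sym2.eq_iff.1 he with ⟨rfl, rfl⟩ | ⟨rfl, rfl⟩
    · exact hne hP
    · exact hne hP.symm
  set M := paramMatrix G w P O α with hM
  have hMapp : ∀ i j, i ≠ j → M i j = if G.Adj i j ∧ P i = P j then - w i j else 0 :=
    aux_paramMatrix_apply G w hwsymm P O hO hOorient α
  have hMsymm : ∀ i j, M i j = M j i := by
    intro i j
    by_cases hij : i = j
    · rw [hij]
    · rw [hMapp i j hij, hMapp j i (Ne.symm hij), hwsymm j i]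
      simp only [G.adj_comm j i, @eq_comm _ (P j) (P i)]
  have hper : ∀ k : Fin ν, ∃ g : {v : V // P v = k} → ℝ, (∀ i, 0 < g i) ∧
      blockMatrix M P k *ᵥ g = lam1Block M P k • g := by
    intro k
    refine aux_perron (G.induce {v | P v = k}) (hPconn k) (blockMatrix M P k) ?_ ?_ ?_
    · exact Matrix.IsHermitian.ext fun i j => by
        simpa [blockMatrix] using hMsymm j.1 i.1
    · intro i j hij
      have hij' : i.1 ≠ j.1 := fun h => hij (Subtype.ext h)
      simp only [blockMatrix, Matrix.submatrix_apply, hMapp _ _ hij']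
      split_ifs with h
      · linarith [hwpos _ _ h.1]
      · exact le_rfl
    · intro i j hij
      have ha : G.Adj i.1 j.1 := hij
      have hP : P i.1 = P j.1 := i.2.trans j.2.symm
      simp only [blockMatrix, Matrix.submatrix_apply, hMapp _ _ ha.ne]
      rw [if_pos ⟨ha, hP⟩]
      linarith [hwpos _ _ ha]
  choose g hgpos hg using hper
  let φ : V → ℝ := fun v => g (P v) ⟨v, rfl⟩
  have hφpos : ∀ v, 0 < φ v := fun v => hgpos _ _
  have hgφ : ∀ k (x : {v : V // P v = k}), g k x = φ x.1 := by
    rintro k ⟨v, rfl⟩; rfl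
  have hMφ : ∀ (c : Fin ν → ℝ) (v : V),
      (M *ᵥ fun v => c (P v) * φ v) v = lam1Block M P (P v) * (c (P v) * φ v) := by
    intro c v
    have h := congrFun (hg (P v)) ⟨v, rfl⟩
    simp only [Matrix.mulVec, dotProduct, Pi.smul_apply, smul_eq_mul, blockMatrix,
      Matrix.submatrix_apply, hgφ] at h ⊢
    have h2 : ∑ x, M v x * (c (P x) * φ x) = ∑ x : {x : V // P x = P v}, M v x.1 * (c (P x.1) * φ x.1) := by
      have hz : ∀ x, x ∉ Finset.univ.filter (fun x => P x = P v) →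
          M v x * (c (P x) * φ x) = 0 := by
        intro x hx
        have hx' : P x ≠ P v := by simpa using hx
        have hvx : v ≠ x := fun h => hx' (by rw [h])
        rw [hMapp v x hvx, if_neg (fun h => hx' h.2.symm), zero_mul]
      rw [← Finset.sum_subset (Finset.subset_univ (Finset.univ.filter (fun x => P x = P v)))
        (fun x _ hx => hz x hx)]
      exact Finset.sum_subtype _ (by simp) _
    rw [h2, mul_left_comm, ← h, Finset.mul_sum]
    refine Finset.sum_congr rfl fun x _ => ?_
    rw [x.2]; ring
  let Φ : (Fin ν → ℝ) →ₗ[ℝ] (V → ℝ) :=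
    { toFun := fun c v => τ v * (c (P v) * φ v)
      map_add' := by intro x y; ext v; simp only [Pi.add_apply]; ring
      map_smul' := by
        intro r x; ext v; simp only [Pi.smul_apply, smul_eq_mul, RingHom.id_apply]; ring }
  set A := signedLaplacian G w (sgnOfEdgeSet Γ) with hAdef
  have hA : A.IsHermitian := aux_herm G w _ hwsymm (hsym Γ)
  have hcard : ν ≤ Fintype.card V := by
    simpa using Fintype.card_le_of_surjective P hPsurj
  have hνpos : 0 < ν := by
    obtain ⟨v⟩ := hGconn.nonempty
    exact (Nat.zero_le _).trans_lt (P v).2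
  have hdiff : ∀ c : Fin ν → ℝ, _ := fun c => aux_diff G w hwsymm P O hO hOorient α hαpos
    (sgnOfEdgeSet Γ) (sgnOfEdgeSet Γt) τ hτ hs hs1 (hsym Γt) hsP (fun v => c (P v) * φ v)
  have hnn : ∀ c : Fin ν → ℝ, ∀ p ∈ O, 0 ≤ w p.1 p.2 * α p *
      (c (P p.1) * φ p.1 + sgnOfEdgeSet Γt p.1 p.2 * (c (P p.2) * φ p.2) / α p) ^ 2 :=
    fun c p hp => mul_nonneg (mul_pos (hwpos _ _ (hO p hp).1) (hαpos p hp)).le (sq_nonneg _)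
  have hle : ∀ c : Fin ν → ℝ, (fun v => c (P v) * φ v) ⬝ᵥ (M *ᵥ fun v => c (P v) * φ v)
      ≤ nthEigenvalue A ν * (Φ c ⬝ᵥ Φ c) := by
    intro c
    simp only [dotProduct, hMφ, Finset.mul_sum]
    refine Finset.sum_le_sum fun v _ => ?_
    have h1 : lam1Block M P (P v) ≤ nthEigenvalue A ν := by
      rw [heq, PartitionEnergy]
      exact le_ciSup (f := fun k => lam1Block M P k) (Set.finite_range _).bddAbove (P v)
    have h2 : Φ c v * Φ c v = (c (P v) * φ v) ^ 2 := by
      change (τ v * (c (P v) * φ v)) * (τ v * (c (P v) * φ v)) = _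
      linear_combination (c (P v) * φ v) ^ 2 * hτ2 v
    rw [h2]
    nlinarith [mul_le_mul_of_nonneg_right h1 (sq_nonneg (c (P v) * φ v))]
  obtain ⟨c, hc0, hc⟩ := aux_minmax A hA hνpos hcard Φ (by
    intro c
    have h1 := hdiff c
    have h2 := Finset.sum_nonneg (hnn c)
    have h3 := hle c
    change Φ c ⬝ᵥ (A *ᵥ Φ c) ≤ _
    change _ = Φ c ⬝ᵥ (A *ᵥ Φ c) + _ at h1
    linarith)
  have hzero : ∀ p ∈ O, c (P p.1) * φ p.1
      + sgnOfEdgeSet Γt p.1 p.2 * (c (P p.2) * φ p.2) / α p = 0 := by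
    have h1 := hdiff c
    have h3 := hle c
    change _ = Φ c ⬝ᵥ (A *ᵥ Φ c) + _ at h1
    rw [hc, dotProduct_smul, smul_eq_mul] at h1
    have h0 := le_antisymm (by linarith) (Finset.sum_nonneg (hnn c))
    intro p hp
    have h4 := (Finset.sum_eq_zero_iff_of_nonneg (hnn c)).1 h0 p hp
    rcases mul_eq_zero.1 h4 with h | h
    · exact absurd h (mul_pos (hwpos _ _ (hO p hp).1) (hαpos p hp)).ne'
    · exact pow_eq_zero_iff (by norm_num) |>.1 h
  -- relation on oriented boundary edges
  have hrel : ∀ i j, (i, j) ∈ O → c (P i) * φ i * α (i, j)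
      = - (sgnOfEdgeSet Γt i j * (c (P j) * φ j)) := by
    intro i j h
    have h1 := hzero _ h
    have h2 := (hαpos _ h).ne'
    simp only at h1
    field_simp at h1
    linarith
  have hstep : ∀ i j, G.Adj i j → (c (P i) = 0 ↔ c (P j) = 0) := by
    have key : ∀ i j, (i, j) ∈ O → (c (P i) = 0 ↔ c (P j) = 0) := by
      intro i j h
      have h1 := hrel i j h
      have h2 := (hαpos _ h).ne'
      have h3 : sgnOfEdgeSet Γt i j ≠ 0 := by
        rcases hs1 i j with h | h <;> rw [h] <;> norm_num
      constructor
      · intro h0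
        rw [h0] at h1
        simpa [h3, (hφpos j).ne'] using h1
      · intro h0
        rw [h0] at h1
        simpa [h2, (hφpos i).ne'] using h1
    intro i j ha
    by_cases hP : P i = P j
    · rw [hP]
    · by_cases h1 : (i, j) ∈ O
      · exact key i j h1
      · have h2 : (j, i) ∈ O := by
          by_contra h2; exact h1 ((hOorient i j ha hP).2 h2)
        exact (key j i h2).symm
  have hcne : ∀ v, c (P v) ≠ 0 := by
    obtain ⟨k, hk⟩ := Function.ne_iff.1 hc0
    obtain ⟨v₀, rfl⟩ := hPsurj k
    exact aux_conn hGconn (fun v => c (P v) ≠ 0)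
      (fun i j h hi hj => hi ((hstep i j h).2 hj)) hk
  have hΦne : ∀ v, Φ c v ≠ 0 := fun v =>
    mul_ne_zero (hτ0 v) (mul_ne_zero (hcne v) (hφpos v).ne')
  have hsgn : ∀ i j, G.Adj i j → Φ c i * sgnOfEdgeSet Γ i j * Φ c j
      = (c (P i) * φ i) * sgnOfEdgeSet Γt i j * (c (P j) * φ j) := by
    intro i j h
    rw [hs i j h]
    change (τ i * (c (P i) * φ i)) * _ * (τ j * (c (P j) * φ j)) = _
    ring
  have hnod : ∀ i j, G.Adj i j → (Φ c i * sgnOfEdgeSet Γ i j * Φ c j < 0 ↔ P i ≠ P j) := by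
    intro i j h
    rw [hsgn i j h]
    have hneg : ∀ i j, (i, j) ∈ O →
        (c (P i) * φ i) * sgnOfEdgeSet Γt i j * (c (P j) * φ j) < 0 := by
      intro i j hij
      have h1 := hrel i j hij
      have h2 : 0 < (c (P i) * φ i) ^ 2 * α (i, j) :=
        mul_pos (by have := mul_ne_zero (hcne i) (hφpos i).ne'; positivity) (hαpos _ hij)
      have h3 : (c (P i) * φ i) * sgnOfEdgeSet Γt i j * (c (P j) * φ j)
        = - ((c (P i) * φ i) ^ 2 * α (i, j)) := by
        linear_combination (c (P i) * φ i) * h1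
      linarith
    constructor
    · intro hlt hP
      rw [hsP i j h hP, hP] at hlt
      have h1 := mul_pos (hφpos i) (hφpos j)
      nlinarith [mul_nonneg (mul_self_nonneg (c (P j))) h1.le]
    · intro hP
      by_cases h1 : (i, j) ∈ O
      · exact hneg i j h1
      · have h2 : (j, i) ∈ O := by
          by_contra h2; exact h1 ((hOorient i j h hP).2 h2)
        have h3 := hneg j i h2
        rw [hsym Γt j i] at h3
        linarith
  refine ⟨Φ c, hc, ?_, hΦne, ?_⟩
  · intro h0
    obtain ⟨v⟩ := hGconn.nonempty
    exact hΦne v (congrFun h0 v)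
  · ext e
    constructor
    · rintro ⟨i, j, he, ha, hlt⟩
      exact ⟨i, j, he, ha, (hnod i j ha).1 hlt⟩
    · rintro ⟨i, j, he, ha, hP⟩
      exact ⟨i, j, he, ha, (hnod i j ha).2 hP⟩

end
end
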